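/- arXiv:1310.5406 — 2 statements merged into one kernel-verified Lean document; each statement's English description precedes it below -/
import Mathlib

section
/- Let G : ℤ →₀ ℤ be a pleasantly alternating cycle and write G_n = Σ_i g_{n,i}·δ_i. Then for every fixed i ∈ ℤ there exist integers a and b and an n_0 ≥ 0 such that g_{n,i} = a for all n ≥ n_0 and g_{n,i} = b for all n ≤ -n_0; moreover either a = 0 and b = -1, or a = 1 and b = 0. -/
/-- The shift of a cycle: `(shiftCyc j G) i = G (i + j)`, i.e. `σ^j(G)`. -/
def shiftCyc (j : ℤ) (G : ℤ →₀ ℤ) : ℤ →₀ ℤ :=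
  Finsupp.equivMapDomain (Equiv.addRight (-j)) G

/-- The cycles `G_n`: `G_0 = 0`; `G_n = Σ_{j=0}^{n-1} σ^{-j}(G)` for `n ≥ 1`; and
`G_{-n} = -Σ_{j=1}^{n} σ^{j}(G)` for `n ≥ 1`. -/
noncomputable def cyc (G : ℤ →₀ ℤ) (n : ℤ) : ℤ →₀ ℤ :=
  if 0 ≤ n then ∑ j ∈ Finset.range n.toNat, shiftCyc (-(j : ℤ)) G
  else -(∑ j ∈ Finset.Icc 1 (-n).toNat, shiftCyc (j : ℤ) G)

/-- `G` is pleasantly alternating with respect to the interval `[r, s]`. -/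
def PleasantlyAlternatingOn (G : ℤ →₀ ℤ) (r s : ℤ) : Prop :=
  r ≤ s ∧ G r = 1 ∧ G s = 1 ∧
  (∀ i, G i ≠ 0 → r ≤ i ∧ i ≤ s) ∧
  (∀ i, G i = -1 ∨ G i = 0 ∨ G i = 1) ∧
  (∀ i j, i < j → G i ≠ 0 → G j ≠ 0 → (∀ t, i < t → t < j → G t = 0) → G j = -G i)

/-- `G` is pleasantly alternating. -/
def PleasantlyAlternating (G : ℤ →₀ ℤ) : Prop :=
  ∃ r s : ℤ, PleasantlyAlternatingOn G r s

theorem shiftCyc_apply (j : ℤ) (G : ℤ →₀ ℤ) (i : ℤ) : shiftCyc j G i = G (i + j) := by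
  simp [shiftCyc]

/-- Any discrete antiderivative `P` of `G` computes the coefficients of `cyc G n`. -/
theorem cyc_apply_eq_sub {G : ℤ →₀ ℤ} {P : ℤ → ℤ} (hP : ∀ x, P x = P (x - 1) + G x) (n i : ℤ) :
    cyc G n i = P i - P (i - n) := by
  have hpos (m : ℕ) : ∑ j ∈ Finset.range m, G (i + -(j : ℤ)) = P i - P (i - m) := by
    induction m with
    | zero => simp
    | succ m ih =>
      rw [Finset.sum_range_succ, ih, ← sub_eq_add_neg, hP (i - m)]
      push_cast
      rw [sub_sub i]
      ring
  have hneg (m : ℕ) : ∑ j ∈ Finset.Icc 1 m, G (i + (j : ℤ)) = P (i + m) - P i := by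
    induction m with
    | zero => simp
    | succ m ih =>
      rw [Finset.sum_Icc_succ_top (by lia), ih, hP (i + (m + 1 : ℕ))]
      push_cast
      rw [← add_assoc, add_sub_cancel_right]
      ring
  unfold cyc
  split_ifs with hn
  · simp only [Finsupp.finsetSum_apply, shiftCyc_apply, hpos, Int.toNat_of_nonneg hn]
  · simp only [Finsupp.neg_apply, Finsupp.finsetSum_apply, shiftCyc_apply, hneg,
      Int.toNat_of_nonneg (show 0 ≤ -n by lia)]
    rw [← sub_eq_add_neg, neg_sub]

theorem sum_Icc_eq_sum_Icc_pred_add {G : ℤ →₀ ℤ} {r : ℤ} (hG : ∀ i < r, G i = 0) (x : ℤ) :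
    ∑ t ∈ Finset.Icc r x, G t = ∑ t ∈ Finset.Icc r (x - 1), G t + G x := by
  rcases lt_or_ge x r with hx | hx
  · rw [Finset.Icc_eq_empty (by lia), Finset.Icc_eq_empty (by lia), hG x hx]
    simp
  · rw [show Finset.Icc r x = insert x (Finset.Icc r (x - 1)) by
      ext t; simp only [Finset.mem_insert, Finset.mem_Icc]; lia,
      Finset.sum_insert (by simp), add_comm]

/-- The partial sum up to `x` is determined by the last nonzero value of `G` up to `x`. -/
theorem PleasantlyAlternatingOn.exists_last_ne_zero {G : ℤ →₀ ℤ} {r s : ℤ}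
    (h : PleasantlyAlternatingOn G r s) {x : ℤ} (hx : r ≤ x) :
    ∃ k ≤ x, G k ≠ 0 ∧ (∀ t, k < t → t ≤ x → G t = 0) ∧
      G k = 2 * ∑ t ∈ Finset.Icc r x, G t - 1 := by
  obtain ⟨-, hr, -, hsupp, -, halt⟩ := h
  induction x, hx using Int.leInduction with
  | base => exact ⟨r, le_rfl, by simp [hr], fun t _ _ => by lia, by simp [hr]⟩
  | succ x hx ih =>
    obtain ⟨k, hk, hk0, hlast, hsum⟩ := ih
    have hstep := sum_Icc_eq_sum_Icc_pred_add (G := G) (r := r)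
      (fun i hi => by by_contra h0; have := hsupp i h0; lia) (x + 1)
    rw [add_sub_cancel_right] at hstep
    by_cases h0 : G (x + 1) = 0
    · refine ⟨k, by lia, hk0, fun t ht htx => ?_, by lia⟩
      rcases eq_or_lt_of_le htx with rfl | htx
      · exact h0
      · exact hlast t ht (by lia)
    · have := halt k (x + 1) (by lia) hk0 h0 fun t ht htx => hlast t ht (by lia)
      exact ⟨x + 1, le_rfl, h0, fun t _ _ => by lia, by lia⟩

/-- For a pleasantly alternating cycle `G` and fixed `i`, the coefficient `g_{n,i} = G_n(i)`
is eventually constant, equal to `a` for `n ≫ 0` and to `b` for `n ≪ 0`, with either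
`a = 0, b = -1` or `a = 1, b = 0`. -/
theorem cyc_coeff_eventually_constant (G : ℤ →₀ ℤ) (h : PleasantlyAlternating G) (i : ℤ) :
    ∃ (a b n₀ : ℤ), 0 ≤ n₀ ∧ (∀ n : ℤ, n₀ ≤ n → cyc G n i = a) ∧
      (∀ n : ℤ, n ≤ -n₀ → cyc G n i = b) ∧
      ((a = 0 ∧ b = -1) ∨ (a = 1 ∧ b = 0)) := by
  obtain ⟨r, s, h⟩ := h
  obtain ⟨hrs, -, hs, hsupp, hval, -⟩ := id h
  let P : ℤ → ℤ := fun x => ∑ t ∈ Finset.Icc r x, G t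
  have hP : ∀ x, P x = P (x - 1) + G x :=
    sum_Icc_eq_sum_Icc_pred_add fun i hi => by by_contra h0; have := hsupp i h0; lia
  have hlow : ∀ x < r, P x = 0 := fun x hx => by simp [P, Finset.Icc_eq_empty_of_lt hx]
  have hhigh : ∀ x, s ≤ x → P x = 1 := fun x hx => by
    obtain ⟨k, -, hk0, hlast, hsum⟩ := h.exists_last_ne_zero (hrs.trans hx)
    have hks : k = s := by
      refine le_antisymm (hsupp k hk0).2 (not_lt.1 fun hlt => ?_)
      have := hlast s hlt hx
      lia
    subst hks
    change G k = 2 * P x - 1 at hsum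
    lia
  have hPi : P i = 0 ∨ P i = 1 := by
    rcases lt_or_ge i r with hi | hi
    · exact Or.inl (hlow i hi)
    · obtain ⟨k, -, hk0, -, hsum⟩ := h.exists_last_ne_zero hi
      change G k = 2 * P i - 1 at hsum
      have := hval k
      lia
  refine ⟨P i, P i - 1, max 0 (max (i - r + 1) (s - i)), le_max_left _ _,
    fun n hn => ?_, fun n hn => ?_, by lia⟩
  · rw [cyc_apply_eq_sub hP, hlow (i - n) (by lia), sub_zero]
  · rw [cyc_apply_eq_sub hP, hhigh (i - n) (by lia)]
end

section
/- Let R be a commutative domain with ring automorphism σ, and let H and J be ideals of R such that for all integers i ≠ j the ideals σ^i(H) + σ^j(H), σ^i(J) + σ^j(J), and σ^i(H) + σ^j(J) all equal R (this encodes that the common support Z of R/H and R/J is σ-lonely). Let G : ℤ →₀ ℤ be a pleasantly alternating cycle supported in [r, s] with G(r) = G(s) = 1, set N = s - r, and let I_n = H[(-G_n)^+] · J[(G_n)^+]. Then for every n ≥ N, I_n · σ^n(I_{-n}) + I_{-n} · σ^{-n}(I_n) = R. -/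
/-- The positive part `D^+ = max(D, 0)` of a cycle, taken pointwise. -/
noncomputable def cycPos (D : ℤ →₀ ℤ) : ℤ →₀ ℤ :=
  Finsupp.mapRange (fun x => max x 0) (by simp) D

/-- For a cycle `D` with values in `{0, 1}`, `I[D] = ∏_{i : D(i) = 1} σ^i(I)`
(empty product is `R`). -/
noncomputable def idealOf {R : Type*} [CommRing R] (σ : R ≃+* R) (I : Ideal R)
    (D : ℤ →₀ ℤ) : Ideal R :=
  ∏ i ∈ D.support.filter (fun i => D i = 1), Ideal.map (σ ^ i) I

/-- The `n`-th component `I_n = H[(-G_n)^+] · J[(G_n)^+]` of the ring `B(G, H, J)`. -/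
noncomputable def BIdeal {R : Type*} [CommRing R] (σ : R ≃+* R) (H J : Ideal R)
    (G : ℤ →₀ ℤ) (n : ℤ) : Ideal R :=
  idealOf σ H (cycPos (-(cyc G n))) * idealOf σ J (cycPos (cyc G n))


/-- A pleasantly alternating cycle has a `{0, 1}`-valued antidifference. -/
theorem PleasantlyAlternatingOn.exists_antidifference {G : ℤ →₀ ℤ} {r s : ℤ}
    (hG : PleasantlyAlternatingOn G r s) :
    ∃ S : ℤ → ℤ, (∀ i, S i = S (i - 1) + G i) ∧ (∀ i, S i = 0 ∨ S i = 1) ∧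
      (∀ i, i < r → S i = 0) ∧ (∀ i, s ≤ i → S i = 1) := by
  obtain ⟨hrs, hr, hs, hsupp, hval, halt⟩ := hG
  have hbelow (i : ℤ) (hi : i < r) : ∑ t ∈ Finset.Icc r i, G t = 0 := by
    rw [Finset.Icc_eq_empty (by lia), Finset.sum_empty]
  have hstep (i : ℤ) :
      ∑ t ∈ Finset.Icc r i, G t = ∑ t ∈ Finset.Icc r (i - 1), G t + G i := by
    rcases lt_or_ge i r with hi | hi
    · have : G i = 0 := by
        by_contra h
        have := (hsupp i h).1
        lia
      rw [hbelow i hi, hbelow (i - 1) (by lia), this, add_zero]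
    · have : Finset.Icc r i = insert i (Finset.Icc r (i - 1)) := by
        ext t
        simp only [Finset.mem_insert, Finset.mem_Icc]
        lia
      rw [this, Finset.sum_insert (by simp), add_comm]
  have hlast (i : ℤ) (hi : r ≤ i) : ∃ m ≤ i, G m ≠ 0 ∧ (∀ t, m < t → t ≤ i → G t = 0) ∧
      2 * ∑ t ∈ Finset.Icc r i, G t = 1 + G m := by
    induction i, hi using Int.leInduction with
    | base => exact ⟨r, le_rfl, by lia, by lia, by simp [hr]⟩
    | succ i hi ih =>
      obtain ⟨m, hm, hm0, hmt, hsum⟩ := ih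
      have hi1 := hstep (i + 1)
      rw [add_sub_cancel_right] at hi1
      by_cases h0 : G (i + 1) = 0
      · refine ⟨m, by lia, hm0, fun t h1 h2 => ?_, by lia⟩
        rcases eq_or_ne t (i + 1) with rfl | h
        · exact h0
        · exact hmt t h1 (by lia)
      · have := halt m (i + 1) (by lia) hm0 h0 fun t h1 h2 => hmt t h1 (by lia)
        exact ⟨i + 1, le_rfl, h0, by lia, by lia⟩
  refine ⟨fun i => ∑ t ∈ Finset.Icc r i, G t, hstep, fun i => ?_, hbelow, fun i hi => ?_⟩
  · rcases lt_or_ge i r with hi | hi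
    · exact Or.inl (hbelow i hi)
    · obtain ⟨m, -, hm0, -, hsum⟩ := hlast i hi
      have := hval m
      lia
  · obtain ⟨m, hm, hm0, hmt, hsum⟩ := hlast i (hrs.trans hi)
    have hms : m = s := by
      refine le_antisymm (hsupp m hm0).2 (not_lt.mp fun h => ?_)
      have := hmt s h hi
      lia
    subst hms
    change ∑ t ∈ Finset.Icc r i, G t = 1
    lia

theorem cyc_apply_of_antidifference {G : ℤ →₀ ℤ} {S : ℤ → ℤ}
    (hS : ∀ i, S i = S (i - 1) + G i) (n i : ℤ) : cyc G n i = S i - S (i - n) := by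
  have hpos (k : ℕ) : ∑ j ∈ Finset.range k, G (i + -(j : ℤ)) = S i - S (i - k) := by
    induction k with
    | zero => simp
    | succ k ih =>
      rw [Finset.sum_range_succ, ih]
      have := hS (i - k)
      rw [show i - (k : ℤ) - 1 = i - ((k + 1 : ℕ) : ℤ) by push_cast; ring] at this
      rw [← sub_eq_add_neg]
      lia
  have hneg (k : ℕ) : ∑ j ∈ Finset.Icc 1 k, G (i + (j : ℤ)) = S (i + k) - S i := by
    induction k with
    | zero => simp
    | succ k ih =>
      rw [Finset.sum_Icc_succ_top (by lia), ih]
      have := hS (i + (k + 1 : ℕ))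
      rw [show i + ((k + 1 : ℕ) : ℤ) - 1 = i + k by push_cast; ring] at this
      lia
  unfold cyc
  split_ifs with hn
  · simp only [Finsupp.finsetSum_apply, shiftCyc_apply]
    rw [hpos, Int.toNat_of_nonneg hn]
  · simp only [Finsupp.neg_apply, Finsupp.finsetSum_apply, shiftCyc_apply]
    rw [hneg, Int.toNat_of_nonneg (by lia), ← sub_eq_add_neg]
    lia

theorem isCoprime_map_idealOf {R : Type*} [CommRing R] (σ : R ≃+* R) {I K : Ideal R}
    (h : ∀ i j : ℤ, i ≠ j → Ideal.map (σ ^ i) I + Ideal.map (σ ^ j) K = ⊤)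
    {D E : ℤ →₀ ℤ} {a b : ℤ} (hDE : ∀ i j, D i = 1 → E j = 1 → a + i ≠ b + j) :
    IsCoprime (Ideal.map (σ ^ a) (idealOf σ I D)) (Ideal.map (σ ^ b) (idealOf σ K E)) := by
  have hmap (c k : ℤ) (L : Ideal R) :
      Ideal.map (σ ^ c) (Ideal.map (σ ^ k) L) = Ideal.map (σ ^ (c + k)) L := by
    rw [zpow_add]
    exact Ideal.map_map (σ ^ k : R ≃+* R).toRingHom (σ ^ c : R ≃+* R).toRingHom
  have hprod (c : ℤ) (L : Ideal R) (t : Finset ℤ) :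
      Ideal.map (σ ^ c) (∏ k ∈ t, Ideal.map (σ ^ k) L) = ∏ k ∈ t, Ideal.map (σ ^ (c + k)) L := by
    simp only [← hmap]
    exact map_prod (Ideal.mapHom (σ ^ c : R ≃+* R)) _ t
  rw [idealOf, idealOf, hprod, hprod]
  refine IsCoprime.prod_left fun i hi => IsCoprime.prod_right fun j hj => ?_
  rw [Ideal.isCoprime_iff_add, Ideal.one_eq_top]
  exact h _ _ (hDE i j (Finset.mem_filter.mp hi).2 (Finset.mem_filter.mp hj).2)

theorem isCoprime_map_BIdeal {R : Type*} [CommRing R] (σ : R ≃+* R) {H J : Ideal R}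
    (hHH : ∀ i j : ℤ, i ≠ j → Ideal.map (σ ^ i) H + Ideal.map (σ ^ j) H = ⊤)
    (hJJ : ∀ i j : ℤ, i ≠ j → Ideal.map (σ ^ i) J + Ideal.map (σ ^ j) J = ⊤)
    (hHJ : ∀ i j : ℤ, i ≠ j → Ideal.map (σ ^ i) H + Ideal.map (σ ^ j) J = ⊤)
    {G : ℤ →₀ ℤ} {m n a b : ℤ}
    (hG : ∀ i j, cyc G m i ≠ 0 → cyc G n j ≠ 0 → a + i ≠ b + j) :
    IsCoprime (Ideal.map (σ ^ a) (BIdeal σ H J G m))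
      (Ideal.map (σ ^ b) (BIdeal σ H J G n)) := by
  have hJH (i j : ℤ) (hij : i ≠ j) : Ideal.map (σ ^ i) J + Ideal.map (σ ^ j) H = ⊤ := by
    rw [add_comm]
    exact hHJ j i hij.symm
  have hpos (D : ℤ →₀ ℤ) (i : ℤ) (h : cycPos D i = 1) : D i ≠ 0 := by
    intro h0
    simp [cycPos, h0] at h
  have hneg (D : ℤ →₀ ℤ) (i : ℤ) (h : cycPos (-D) i = 1) : D i ≠ 0 := by
    simpa using hpos (-D) i h
  simp only [BIdeal, Ideal.map_mul]
  refine .mul_left (.mul_right ?_ ?_) (.mul_right ?_ ?_)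
  · exact isCoprime_map_idealOf σ hHH fun i j hi hj => hG i j (hneg _ i hi) (hneg _ j hj)
  · exact isCoprime_map_idealOf σ hHJ fun i j hi hj => hG i j (hneg _ i hi) (hpos _ j hj)
  · exact isCoprime_map_idealOf σ hJH fun i j hi hj => hG i j (hpos _ i hi) (hneg _ j hj)
  · exact isCoprime_map_idealOf σ hJJ fun i j hi hj => hG i j (hpos _ i hi) (hpos _ j hj)

/-- If the `σ`-translates of `H` and of `J` (and mixed pairs) are pairwise comaximal
(encoding that the common support `Z` of `R/H` and `R/J` is `σ`-lonely), then for every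
`n ≥ N = s - r` one has `I_n · σ^n(I_{-n}) + I_{-n} · σ^{-n}(I_n) = R`. -/
theorem BIdeal_comaximal (R : Type*) [CommRing R] [IsDomain R] (σ : R ≃+* R)
    (H J : Ideal R)
    (hHH : ∀ i j : ℤ, i ≠ j → Ideal.map (σ ^ i) H + Ideal.map (σ ^ j) H = ⊤)
    (hJJ : ∀ i j : ℤ, i ≠ j → Ideal.map (σ ^ i) J + Ideal.map (σ ^ j) J = ⊤)
    (hHJ : ∀ i j : ℤ, i ≠ j → Ideal.map (σ ^ i) H + Ideal.map (σ ^ j) J = ⊤)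
    (G : ℤ →₀ ℤ) (r s : ℤ) (hG : PleasantlyAlternatingOn G r s)
    (N : ℤ) (hN : N = s - r) :
    ∀ n : ℤ, N ≤ n →
      BIdeal σ H J G n * Ideal.map (σ ^ n) (BIdeal σ H J G (-n)) +
        BIdeal σ H J G (-n) * Ideal.map (σ ^ (-n)) (BIdeal σ H J G n) = ⊤ := by
  intro n hn
  obtain ⟨S, hS, h01, hlt, hge⟩ := hG.exists_antidifference
  have hcyc (m i : ℤ) : cyc G m i = S i - S (i - m) := cyc_apply_of_antidifference hS m i
  have hmono (i : ℤ) : S (i - n) ≤ S i := by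
    rcases lt_or_ge (i - n) r with h | h
    · have := hlt _ h
      have := h01 i
      lia
    · have := hge i (by lia)
      have := h01 (i - n)
      lia
  have hdisj (k : ℤ) (h1 : S k ≠ S (k - n)) (h2 : S k ≠ S (k + n)) : False := by
    have hk := hmono k
    have hkn := hmono (k + n)
    rw [add_sub_cancel_right] at hkn
    have := h01 k
    have := h01 (k - n)
    have := h01 (k + n)
    lia
  have hcop {m m' a b : ℤ}
      (h : ∀ i j, cyc G m i ≠ 0 → cyc G m' j ≠ 0 → a + i ≠ b + j) :=
    isCoprime_map_BIdeal σ hHH hJJ hHJ h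
  have hzero (I : Ideal R) : Ideal.map (σ ^ (0 : ℤ)) I = I := by
    rw [zpow_zero]
    exact Ideal.map_id I
  rw [← Ideal.one_eq_top, ← Ideal.isCoprime_iff_add]
  have key : IsCoprime
      (Ideal.map (σ ^ (0 : ℤ)) (BIdeal σ H J G n) * Ideal.map (σ ^ n) (BIdeal σ H J G (-n)))
      (Ideal.map (σ ^ (0 : ℤ)) (BIdeal σ H J G (-n)) *
        Ideal.map (σ ^ (-n)) (BIdeal σ H J G n)) := by
    refine .mul_left (.mul_right ?_ ?_) (.mul_right ?_ ?_) <;>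
      refine hcop fun i j hi hj hij => ?_ <;>
      rw [hcyc, sub_ne_zero] at hi hj
    · obtain rfl : j = i := by lia
      exact hdisj j hi (by rwa [sub_neg_eq_add] at hj)
    · obtain rfl : j = i + n := by lia
      exact hdisj i hi (by rw [add_sub_cancel_right] at hj; exact hj.symm)
    · obtain rfl : j = i + n := by lia
      rw [sub_neg_eq_add] at hi hj
      exact hdisj (i + n) (by rw [add_sub_cancel_right]; exact hi.symm) hj
    · obtain rfl : j = i + n + n := by lia
      rw [sub_neg_eq_add] at hi
      rw [add_sub_cancel_right] at hj
      exact hdisj (i + n) (by rw [add_sub_cancel_right]; exact hi.symm) hj.symm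
  rwa [hzero, hzero] at key
end
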